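/- Let S² be the unit sphere in the Euclidean space ℝ³ with its standard smooth manifold structure, and let M be the total space of the tangent bundle of S² with its bundle topology. Then there do not exist a topological space N, points b ∈ M and r ∈ N, a function f : M → N, and a continuous map φ : M × M × N → M × M × N homotopic to the identity map of M × M × N with φ(x, b, r) = (x, x, f x) for all x ∈ M. -/

import Mathlib

open scoped Manifold

instance : Fact (Module.finrank ℝ (EuclideanSpace ℝ (Fin 3)) = 2 + 1) :=
  ⟨by simp⟩

namespace PendulumAux

/-- The unit two-sphere. -/
abbrev S2 := Metric.sphere (0 : EuclideanSpace ℝ (Fin 3)) 1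

/-- Stepping along the unit interval. -/
lemma stepping (Q : ℝ → Prop) (δ : ℝ) (hδ : 0 < δ) (h0 : Q 0)
    (hs : ∀ t ∈ Set.Icc (0 : ℝ) 1, ∀ t' ∈ Set.Icc (0 : ℝ) 1, |t - t'| < δ → Q t → Q t') : Q 1 := by
  obtain ⟨n, hn⟩ := exists_nat_one_div_lt hδ
  have hp : (0 : ℝ) < n + 1 := by positivity
  have key : ∀ k : ℕ, k ≤ n + 1 → Q (k / (n + 1)) := by
    intro k
    induction k with
    | zero => intro _; simpa using h0
    | succ k ih =>
      intro hk
      have hk' : (k : ℝ) + 1 ≤ n + 1 := by exact_mod_cast hk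
      refine hs _ ⟨by positivity, ?_⟩ _ ⟨by positivity, ?_⟩ ?_ (ih (by omega))
      · rw [div_le_one hp]; linarith
      · rw [div_le_one hp]; push_cast; linarith
      · have : (k : ℝ) / (n + 1) - ((k + 1 : ℕ) : ℝ) / (n + 1) = -(1 / (n + 1)) := by
          push_cast; field_simp; ring
        rw [this, abs_neg, abs_of_pos (by positivity)]
        exact hn
  have := key (n + 1) le_rfl
  push_cast at this
  rwa [div_self hp.ne'] at this

/-- A nowhere zero function on the closed disk is an exponential. -/
lemma disk_log (h : ℂ → ℂ) (hc : ContinuousOn h (Metric.closedBall 0 1))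
    (hn : ∀ z ∈ Metric.closedBall (0 : ℂ) 1, h z ≠ 0) :
    ∃ L : ℂ → ℂ, ContinuousOn L (Metric.closedBall 0 1) ∧
      ∀ z ∈ Metric.closedBall (0 : ℂ) 1, Complex.exp (L z) = h z := by
  have hK : IsCompact (Metric.closedBall (0 : ℂ) 1) := isCompact_closedBall 0 1
  have huc := hK.uniformContinuousOn_of_continuous hc
  obtain ⟨z0, hz0, hmin⟩ := hK.exists_isMinOn ⟨0, by simp⟩ hc.norm
  have hm : 0 < ‖h z0‖ := norm_pos_iff.2 (hn z0 hz0)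
  obtain ⟨δ, hδ, hu⟩ := Metric.uniformContinuousOn_iff.1 huc _ hm
  have hmem : ∀ t ∈ Set.Icc (0 : ℝ) 1, ∀ z ∈ Metric.closedBall (0 : ℂ) 1,
      (t : ℂ) * z ∈ Metric.closedBall (0 : ℂ) 1 := by
    intro t ht z hz
    simp only [mem_closedBall_zero_iff] at *
    rw [norm_mul, Complex.norm_real, Real.norm_of_nonneg ht.1]
    nlinarith [ht.1, ht.2, norm_nonneg z]
  have hct : ∀ t ∈ Set.Icc (0 : ℝ) 1,
      ContinuousOn (fun z => h ((t : ℂ) * z)) (Metric.closedBall 0 1) := by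
    intro t ht
    exact hc.comp (by fun_prop) (fun z hz => hmem t ht z hz)
  have := stepping (fun t => ∃ L : ℂ → ℂ, ContinuousOn L (Metric.closedBall 0 1) ∧
      ∀ z ∈ Metric.closedBall (0 : ℂ) 1, Complex.exp (L z) = h (t * z)) δ hδ
    ⟨fun _ => Complex.log (h 0), continuousOn_const, fun z _ => by
      simp [Complex.exp_log (hn 0 (by simp))]⟩ ?_
  · simpa using this
  · rintro t ht t' ht' htt ⟨L, hL, hLe⟩
    refine ⟨fun z => L z + Complex.log (h (t' * z) / h (t * z)), ?_, ?_⟩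
    · refine hL.add (ContinuousOn.clog ((hct t' ht').div (hct t ht)
        fun z hz => hn _ (hmem t ht z hz)) ?_)
      intro z hz
      have hne := hn _ (hmem t ht z hz)
      have e : h (t' * z) / h (t * z) = 1 + (h (t' * z) - h (t * z)) / h (t * z) := by
        rw [sub_div, div_self hne]; ring
      rw [e]
      apply Complex.mem_slitPlane_of_norm_lt_one
      rw [norm_div, div_lt_one (norm_pos_iff.2 hne), ← dist_eq_norm]
      refine lt_of_lt_of_le (hu _ (hmem t' ht' z hz) _ (hmem t ht z hz) ?_) (hmin (hmem t ht z hz))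
      rw [dist_eq_norm, ← sub_mul, norm_mul, ← Complex.ofReal_sub, Complex.norm_real,
        Real.norm_eq_abs, abs_sub_comm]
      rw [mem_closedBall_zero_iff] at hz
      nlinarith [abs_nonneg (t - t'), norm_nonneg z]
    · intro z hz
      rw [Complex.exp_add, hLe z hz, Complex.exp_log, mul_div_cancel₀]
      · exact hn _ (hmem t ht z hz)
      · exact div_ne_zero (hn _ (hmem t' ht' z hz)) (hn _ (hmem t ht z hz))

lemma no_winding (h : ℂ → ℂ) (hc : ContinuousOn h (Metric.closedBall 0 1))
    (hn : ∀ z ∈ Metric.closedBall (0 : ℂ) 1, h z ≠ 0) (c : ℂ)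
    (hb : ∀ z : ℂ, ‖z‖ = 1 → h z = z * c) : False := by
  obtain ⟨L, hL, hLe⟩ := disk_log h hc hn
  let u : ℝ → ℂ := fun θ => L (Complex.exp (θ * Complex.I)) - θ * Complex.I - L 1
  have hmem : ∀ θ : ℝ, Complex.exp (θ * Complex.I) ∈ Metric.closedBall (0 : ℂ) 1 := by
    intro θ; simp [Complex.norm_exp_ofReal_mul_I]
  have huc : Continuous u := by
    have : Continuous fun θ : ℝ => L (Complex.exp (θ * Complex.I)) :=
      hL.comp_continuous (by fun_prop) hmem
    exact (this.sub (by fun_prop)).sub continuous_const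
  have h1 : h 1 = c := by simpa using hb 1 (by simp)
  have hc0 : c ≠ 0 := h1 ▸ hn 1 (by simp)
  have hue : ∀ θ, ∃ n : ℤ, u θ = n * (2 * Real.pi * Complex.I) := by
    intro θ
    apply Complex.exp_eq_one_iff.1
    simp only [u]
    rw [Complex.exp_sub, Complex.exp_sub, hLe _ (hmem θ), hLe 1 (by simp), h1,
      hb _ (Complex.norm_exp_ofReal_mul_I θ)]
    have := Complex.exp_ne_zero (θ * Complex.I)
    field_simp
  let v : ℝ → ℝ := fun θ => (u θ).im / (2 * Real.pi)
  have hv : Continuous v := by fun_prop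
  have hvz : ∀ θ, ∃ n : ℤ, v θ = n := by
    intro θ
    obtain ⟨n, hn⟩ := hue θ
    refine ⟨n, ?_⟩
    simp only [v, hn]
    have := Real.pi_pos
    simp
  have e0 : v 0 = 0 := by simp [v, u]
  have e1 : v (2 * Real.pi) = -1 := by
    have := Real.pi_pos
    simp [v, u, Complex.exp_two_pi_mul_I]
  have : (-1 / 2 : ℝ) ∈ Set.range v :=
    mem_range_of_exists_le_of_exists_ge hv ⟨2 * Real.pi, by rw [e1]; norm_num⟩
      ⟨0, by rw [e0]; norm_num⟩
  obtain ⟨θ, hθ⟩ := this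
  obtain ⟨n, hn⟩ := hvz θ
  have h2 : (2 * n : ℝ) = -1 := by linarith
  have : 2 * n = -1 := by exact_mod_cast h2
  omega

/-- `(w₁, w₂)` is a nonzero vector on the line determined by the point `x`. -/
def OnLine (x : S2) (p q : ℂ) : Prop :=
  (1 + (x.1 2 : ℂ)) * p + ((x.1 0 : ℂ) - Complex.I * (x.1 1 : ℂ)) * q = 2 * p ∧
  ((x.1 0 : ℂ) + Complex.I * (x.1 1 : ℂ)) * p + (1 - (x.1 2 : ℂ)) * q = 2 * q ∧
  ¬ (p = 0 ∧ q = 0)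

lemma sphere_eq (x : S2) : x.1 0 ^ 2 + x.1 1 ^ 2 + x.1 2 ^ 2 = 1 := by
  have h := x.2
  rw [mem_sphere_zero_iff_norm] at h
  have h2 := EuclideanSpace.real_norm_sq_eq x.1
  rw [h, Fin.sum_univ_three] at h2
  linarith

lemma onLine_step (x y : S2) (hd : dist x y < 1) (p q : ℂ) (h : OnLine x p q) :
    OnLine y ((1 + (y.1 2 : ℂ)) * p + ((y.1 0 : ℂ) - Complex.I * (y.1 1 : ℂ)) * q)
      (((y.1 0 : ℂ) + Complex.I * (y.1 1 : ℂ)) * p + (1 - (y.1 2 : ℂ)) * q) := by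
  obtain ⟨h1, h2, h3⟩ := h
  have hy : (y.1 0 : ℂ) ^ 2 + (y.1 1 : ℂ) ^ 2 + (y.1 2 : ℂ) ^ 2 = 1 := by
    have := congrArg (fun a : ℝ => (a : ℂ)) (sphere_eq y)
    push_cast at this
    exact this
  have hI := Complex.I_sq
  have hdist : (x.1 0 - y.1 0) ^ 2 + (x.1 1 - y.1 1) ^ 2 + (x.1 2 - y.1 2) ^ 2 < 1 := by
    have hs : ‖x.1 - y.1‖ ^ 2 < 1 := by
      rw [← dist_eq_norm]
      have : dist x.1 y.1 < 1 := hd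
      have := dist_nonneg (x := x.1) (y := y.1)
      nlinarith
    rw [EuclideanSpace.real_norm_sq_eq, Fin.sum_univ_three] at hs
    simpa using hs
  refine ⟨?_, ?_, ?_⟩
  · linear_combination p * hy - p * (y.1 1 : ℂ) ^ 2 * hI
  · linear_combination q * hy - q * (y.1 1 : ℂ) ^ 2 * hI
  · rintro ⟨g1, g2⟩
    set d : ℝ := (x.1 0 - y.1 0) ^ 2 + (x.1 1 - y.1 1) ^ 2 + (x.1 2 - y.1 2) ^ 2 with hdd
    have hdC : (d : ℂ) = ((x.1 0 : ℂ) - y.1 0) ^ 2 + ((x.1 1 : ℂ) - y.1 1) ^ 2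
      + ((x.1 2 : ℂ) - y.1 2) ^ 2 := by rw [hdd]; push_cast; ring
    have k1 : ((x.1 2 : ℂ) - y.1 2) * p
        + (((x.1 0 : ℂ) - y.1 0) - Complex.I * ((x.1 1 : ℂ) - y.1 1)) * q = 2 * p := by
      linear_combination h1 - g1
    have k2 : (((x.1 0 : ℂ) - y.1 0) + Complex.I * ((x.1 1 : ℂ) - y.1 1)) * p
        - ((x.1 2 : ℂ) - y.1 2) * q = 2 * q := by
      linear_combination h2 - g2
    have hd4 : (d : ℂ) - 4 ≠ 0 := by
      intro hh
      have : (d : ℂ) = (4 : ℝ) := by push_cast; linear_combination hh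
      have := Complex.ofReal_injective this
      linarith
    have m1 : ((d : ℂ) - 4) * p = 0 := by
      rw [hdC]
      linear_combination (((x.1 2 : ℂ) - y.1 2) + 2) * k1
        + (((x.1 0 : ℂ) - y.1 0) - Complex.I * ((x.1 1 : ℂ) - y.1 1)) * k2
        + p * ((x.1 1 : ℂ) - y.1 1) ^ 2 * hI
    have m2 : ((d : ℂ) - 4) * q = 0 := by
      rw [hdC]
      linear_combination (-((x.1 2 : ℂ) - y.1 2) + 2) * k2
        + (((x.1 0 : ℂ) - y.1 0) + Complex.I * ((x.1 1 : ℂ) - y.1 1)) * k1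
        + q * ((x.1 1 : ℂ) - y.1 1) ^ 2 * hI
    exact h3 ⟨(mul_eq_zero.1 m1).resolve_left hd4, (mul_eq_zero.1 m2).resolve_left hd4⟩

lemma onLine_exists (x : S2) : ∃ p q, OnLine x p q := by
  have hx : (x.1 0 : ℂ) ^ 2 + (x.1 1 : ℂ) ^ 2 + (x.1 2 : ℂ) ^ 2 = 1 := by
    have := congrArg (fun a : ℝ => (a : ℂ)) (sphere_eq x)
    push_cast at this
    exact this
  have hI := Complex.I_sq
  by_cases h : (1 + (x.1 2 : ℂ)) = 0
  · refine ⟨(x.1 0 : ℂ) - Complex.I * (x.1 1 : ℂ), 1 - (x.1 2 : ℂ), ?_, ?_, ?_⟩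
    · ring
    · linear_combination hx - (x.1 1 : ℂ) ^ 2 * hI
    · rintro ⟨-, h2⟩
      have : (2 : ℂ) = 0 := by linear_combination h + h2
      norm_num at this
  · refine ⟨1 + (x.1 2 : ℂ), (x.1 0 : ℂ) + Complex.I * (x.1 1 : ℂ), ?_, ?_, fun h2 => h h2.1⟩
    · linear_combination hx - (x.1 1 : ℂ) ^ 2 * hI
    · ring

lemma no_section (s t : S2 → ℂ) (hs : Continuous s) (ht : Continuous t)
    (h : ∀ x, OnLine x (s x) (t x)) : False := by
  let ρ : ℂ → ℂ := fun z => z / ((max 1 ‖z‖ : ℝ) : ℂ)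
  have hmax : ∀ z : ℂ, (max 1 ‖z‖ : ℝ) ≠ 0 := fun z =>
    (lt_of_lt_of_le one_pos (le_max_left 1 ‖z‖)).ne'
  have hρc : Continuous ρ := by
    apply Continuous.div continuous_id (by fun_prop)
    intro z
    exact_mod_cast hmax z
  have hρ1 : ∀ z, ‖ρ z‖ ≤ 1 := by
    intro z
    have h1 : (0 : ℝ) < max 1 ‖z‖ := lt_of_lt_of_le one_pos (le_max_left 1 ‖z‖)
    simp only [ρ]
    rw [norm_div, Complex.norm_real, Real.norm_of_nonneg h1.le, div_le_one h1]
    exact le_max_right _ _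
  have hρ2 : ∀ z : ℂ, ‖z‖ = 1 → ρ z = z := by
    intro z hz
    simp [ρ, hz]
  let w : ℂ → ℝ := fun z => Real.sqrt (1 - ‖ρ z‖ ^ 2)
  have hwc : Continuous w := by
    simp only [w]
    fun_prop
  have hw : ∀ z, w z ^ 2 = 1 - ((ρ z).re ^ 2 + (ρ z).im ^ 2) := by
    intro z
    simp only [w]
    rw [Real.sq_sqrt]
    · rw [Complex.sq_norm, Complex.normSq_apply]; ring
    · nlinarith [hρ1 z, norm_nonneg (ρ z)]
  let P : ℂ → S2 := fun z =>
    ⟨!₂[2 * w z * (ρ z).re, -(2 * w z * (ρ z).im), 1 - 2 * w z ^ 2], by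
      rw [mem_sphere_zero_iff_norm, ← sq_eq_sq₀ (norm_nonneg _) zero_le_one,
        EuclideanSpace.real_norm_sq_eq, Fin.sum_univ_three]
      simp
      linear_combination 4 * w z ^ 2 * hw z⟩
  have hPc : Continuous P := by
    apply Continuous.subtype_mk
    fun_prop
  refine no_winding (fun z => ρ z * (starRingEnd ℂ) (s (P z)) + w z * (starRingEnd ℂ) (t (P z)))
    ?_ ?_ ((starRingEnd ℂ) (s (P 1))) ?_
  · apply Continuous.continuousOn
    fun_prop
  · intro z _ h0
    have h0' := congrArg (starRingEnd ℂ) h0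
    simp only [map_add, map_mul, Complex.conj_conj, Complex.conj_ofReal, map_zero] at h0'
    obtain ⟨h1, h2, h3⟩ := h (P z)
    have hI := Complex.I_sq
    have hwC : (w z : ℂ) ^ 2 = 1 - ((ρ z).re ^ 2 + (ρ z).im ^ 2) := by
      have := congrArg (fun a : ℝ => (a : ℂ)) (hw z)
      push_cast at this
      exact this
    have hz : ρ z = (ρ z).re + (ρ z).im * Complex.I := (Complex.re_add_im _).symm
    have hzc : (starRingEnd ℂ) (ρ z) = (ρ z).re - (ρ z).im * Complex.I := by
      apply Complex.ext <;> simp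
    rw [hzc] at h0'
    simp only [P, Matrix.cons_val_zero, Matrix.cons_val_one, Matrix.cons_val, Complex.ofReal_mul,
      Complex.ofReal_neg, Complex.ofReal_sub, Complex.ofReal_pow, Complex.ofReal_one,
      Complex.ofReal_ofNat] at h1 h2
    change s (P z) = 0 ∧ t (P z) = 0 → False at h3
    change (1 + (1 - 2 * (w z : ℂ) ^ 2)) * s (P z) + (2 * (w z : ℂ) * (ρ z).re -
      Complex.I * -(2 * (w z : ℂ) * (ρ z).im)) * t (P z) = 2 * s (P z) at h1
    change (2 * (w z : ℂ) * (ρ z).re +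
      Complex.I * -(2 * (w z : ℂ) * (ρ z).im)) * s (P z) +
      (1 - (1 - 2 * (w z : ℂ) ^ 2)) * t (P z) = 2 * t (P z) at h2
    refine h3 ⟨?_, ?_⟩
    · linear_combination (-1 / 2 : ℂ) * h1 + ((ρ z).re + (ρ z).im * Complex.I) * h0'
        - s (P z) * hwC + s (P z) * (ρ z).im ^ 2 * hI
    · linear_combination (-1 / 2 : ℂ) * h2 + (w z : ℂ) * h0'
  · intro z hz
    have hw0 : ∀ z : ℂ, ‖z‖ = 1 → w z = 0 := by
      intro z hz
      simp [w, hρ2 z hz, hz]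
    have hP : P z = P 1 := by
      apply Subtype.ext
      simp only [P, hw0 z hz, hw0 1 (by simp)]
      simp
    simp only [hw0 z hz, hρ2 z hz, hP]
    simp

lemma sphere_not_null (c : S2) (H : (ContinuousMap.id S2).Homotopic (ContinuousMap.const S2 c)) :
    False := by
  obtain ⟨H⟩ := H.symm
  have huc := CompactSpace.uniformContinuous_of_continuous H.continuous
  obtain ⟨δ, hδ, hu⟩ := Metric.uniformContinuous_iff.1 huc 1 one_pos
  have := stepping (fun t => ∃ p q : S2 → ℂ, Continuous p ∧ Continuous q ∧
    ∀ x, OnLine (H (Set.projIcc 0 1 zero_le_one t, x)) (p x) (q x)) δ hδ ?_ ?_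
  · obtain ⟨p, q, hp, hq, h⟩ := this
    refine no_section p q hp hq fun x => ?_
    have := h x
    rw [Set.projIcc_right] at this
    have e : H ((⟨1, by simp⟩ : Set.Icc (0:ℝ) 1), x) = x := H.apply_one x
    rwa [e] at this
  · obtain ⟨p, q, h⟩ := onLine_exists c
    refine ⟨fun _ => p, fun _ => q, continuous_const, continuous_const, fun x => ?_⟩
    rw [Set.projIcc_left]
    have e : H ((⟨0, by simp⟩ : Set.Icc (0:ℝ) 1), x) = c := H.apply_zero x
    rwa [e]
  · rintro a ha b hb hab ⟨p, q, hp, hq, h⟩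
    rw [Set.projIcc_of_mem _ ha] at h
    rw [Set.projIcc_of_mem _ hb]
    refine ⟨_, _, ?_, ?_, fun x => onLine_step _ _ ?_ _ _ (h x)⟩
    · fun_prop
    · fun_prop
    · apply hu
      rw [Prod.dist_eq]
      simpa [Subtype.dist_eq, Real.dist_eq] using hab

end PendulumAux

/-- The spherical pendulum cannot be cloned: the total space of the tangent bundle of
`S²` (homeomorphic to the phase space `T*S²`) admits no continuous cloning map homotopic
to the identity. -/
theorem spherical_pendulum_no_cloning :
    ∀ (N : Type) [TopologicalSpace N]
      (b : TangentBundle (𝓡 2) (Metric.sphere (0 : EuclideanSpace ℝ (Fin 3)) 1)) (r : N)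
      (f : TangentBundle (𝓡 2) (Metric.sphere (0 : EuclideanSpace ℝ (Fin 3)) 1) → N)
      (φ : C(TangentBundle (𝓡 2) (Metric.sphere (0 : EuclideanSpace ℝ (Fin 3)) 1) ×
               TangentBundle (𝓡 2) (Metric.sphere (0 : EuclideanSpace ℝ (Fin 3)) 1) × N,
             TangentBundle (𝓡 2) (Metric.sphere (0 : EuclideanSpace ℝ (Fin 3)) 1) ×
               TangentBundle (𝓡 2) (Metric.sphere (0 : EuclideanSpace ℝ (Fin 3)) 1) × N)),
      φ.Homotopic (ContinuousMap.id _) →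
      (∀ x : TangentBundle (𝓡 2) (Metric.sphere (0 : EuclideanSpace ℝ (Fin 3)) 1),
        φ (x, b, r) = (x, x, f x)) →
      False := by
  intro N _ b r f φ hφ hx
  obtain ⟨G⟩ := hφ
  let z : C(PendulumAux.S2, TangentBundle (𝓡 2) PendulumAux.S2) :=
    ⟨Bundle.zeroSection _ _, Bundle.Trivialization.continuous_zeroSection ℝ⟩
  let π : C(TangentBundle (𝓡 2) PendulumAux.S2, PendulumAux.S2) :=
    ⟨Bundle.TotalSpace.proj, FiberBundle.continuous_proj _ _⟩
  let i : C(PendulumAux.S2, TangentBundle (𝓡 2) PendulumAux.S2 ×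
      TangentBundle (𝓡 2) PendulumAux.S2 × N) :=
    ⟨fun x => (z x, b, r), by fun_prop⟩
  let j : C(TangentBundle (𝓡 2) PendulumAux.S2 ×
      TangentBundle (𝓡 2) PendulumAux.S2 × N, PendulumAux.S2) :=
    ⟨fun y => π y.2.1, by fun_prop⟩
  refine PendulumAux.sphere_not_null (π b) ?_
  have key : ((j.comp φ).comp i).Homotopic ((j.comp (ContinuousMap.id _)).comp i) :=
    (((ContinuousMap.Homotopic.refl j).comp ⟨G⟩).comp (ContinuousMap.Homotopic.refl i))
  convert key using 1
  · ext1 x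
    change x = π (φ (z x, b, r)).2.1
    rw [hx]
    rfl
  · ext1 x
    rfl
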